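/- arXiv:1209.0815 — 7 statements merged into one kernel-verified Lean document; each statement's English description precedes it below -/
import Mathlib

section
/- With X, Y, f, e, M, M' as in the context: M(N) → ∞ as N → ∞ if and only if M'(N) → ∞ as N → ∞ (limits taken in [0,∞]). -/
open Filter ENNReal

/-- The Gromov product `(a·b)_e` in a metric space. -/
noncomputable def gromovProd {X : Type*} [MetricSpace X] (e a b : X) : ℝ :=
  (dist a e + dist b e - dist a b) / 2

/-- `X` is `(δ)`-hyperbolic. -/
def IsDeltaHyperbolic (X : Type*) [MetricSpace X] (δ : ℝ) : Prop :=
  ∀ e a b c : X, gromovProd e a b ≥ min (gromovProd e a c) (gromovProd e b c) - δ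

/-- `γ : ℝ → X` restricts to a geodesic from `a` to `b` on `[0, dist a b]`. -/
def IsGeodesicFromTo {X : Type*} [MetricSpace X] (γ : ℝ → X) (a b : X) : Prop :=
  γ 0 = a ∧ γ (dist a b) = b ∧
    ∀ s ∈ Set.Icc (0 : ℝ) (dist a b), ∀ t ∈ Set.Icc (0 : ℝ) (dist a b),
      dist (γ s) (γ t) = |s - t|

/-- Every pair of points of `X` is joined by a geodesic. -/
def IsGeodesicSpace (X : Type*) [MetricSpace X] : Prop :=
  ∀ a b : X, ∃ γ : ℝ → X, IsGeodesicFromTo γ a b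

/-- `f` is metrically proper (relative to the basepoint `e`). -/
def MetricallyProper {Y X : Type*} [MetricSpace Y] [MetricSpace X]
    (f : Y → X) (e : Y) : Prop :=
  ∀ R : ℝ, ∃ S : ℝ, ∀ y : Y, dist (f y) (f e) ≤ R → dist y e ≤ S

/-- `M(N)`: the infimum in `[0,∞]` of the Gromov products `(f x · f y)_{f e}`
over pairs `x, y ∈ Y` with `(x·y)_e ≥ N`.  The infimum of the empty set is `∞`. -/
noncomputable def Mfun {Y X : Type*} [MetricSpace Y] [MetricSpace X]
    (f : Y → X) (e : Y) (N : ℝ) : ℝ≥0∞ :=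
  sInf {p : ℝ≥0∞ | ∃ x y : Y, N ≤ gromovProd e x y ∧
    p = ENNReal.ofReal (gromovProd (f e) (f x) (f y))}

/-- `M'(N)`: the infimum in `[0,∞]` of the distances from `f e` to the images of
geodesics in `X` from `f x` to `f y`, over pairs `x, y ∈ Y` joined by some geodesic
in `Y` whose image avoids the open ball of radius `N` about `e`. -/
noncomputable def M'fun {Y X : Type*} [MetricSpace Y] [MetricSpace X]
    (f : Y → X) (e : Y) (N : ℝ) : ℝ≥0∞ :=
  sInf {p : ℝ≥0∞ | ∃ x y : Y,
    (∃ γY : ℝ → Y, IsGeodesicFromTo γY x y ∧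
      ∀ s ∈ Set.Icc (0 : ℝ) (dist x y), N ≤ dist e (γY s)) ∧
    ∃ γX : ℝ → X, IsGeodesicFromTo γX (f x) (f y) ∧
      p = EMetric.infEdist (f e) (γX '' Set.Icc (0 : ℝ) (dist (f x) (f y)))}

/-- The Gromov product is at most the distance to any point of a geodesic. -/
theorem gromovProd_le_dist {X : Type*} [MetricSpace X] {γ : ℝ → X} {a b : X}
    (hγ : IsGeodesicFromTo γ a b) (e : X) {t : ℝ} (ht : t ∈ Set.Icc (0 : ℝ) (dist a b)) :
    gromovProd e a b ≤ dist e (γ t) := by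
  obtain ⟨h0, h1, h⟩ := hγ
  have ha := h 0 ⟨le_rfl, dist_nonneg⟩ t ht
  have hb := h t ht _ ⟨dist_nonneg, le_rfl⟩
  rw [h0, zero_sub, abs_neg, abs_of_nonneg ht.1] at ha
  rw [h1, abs_sub_comm, abs_of_nonneg (sub_nonneg.2 ht.2)] at hb
  have h2 := dist_triangle_right a e (γ t)
  have h3 := dist_triangle_left b e (γ t)
  rw [dist_comm (γ t) e] at h3
  unfold gromovProd
  linarith

/-- In a hyperbolic space, a geodesic comes within the Gromov product plus `2 * δ` of `e`. -/
theorem IsDeltaHyperbolic.exists_dist_le {X : Type*} [MetricSpace X] {δ : ℝ}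
    (hX : IsDeltaHyperbolic X δ) {γ : ℝ → X} {a b : X}
    (hγ : IsGeodesicFromTo γ a b) (e : X) :
    ∃ t ∈ Set.Icc (0 : ℝ) (dist a b), dist e (γ t) ≤ gromovProd e a b + 2 * δ := by
  obtain ⟨h0, h1, h⟩ := hγ
  have ht : (dist a e + dist a b - dist b e) / 2 ∈ Set.Icc (0 : ℝ) (dist a b) := by
    have h2 := dist_triangle b a e
    have h3 := dist_triangle a b e
    rw [dist_comm b a] at h2
    constructor <;> linarith
  refine ⟨_, ht, ?_⟩
  set t := (dist a e + dist a b - dist b e) / 2 with htdef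
  have ha := h 0 ⟨le_rfl, dist_nonneg⟩ t ht
  have hb := h t ht _ ⟨dist_nonneg, le_rfl⟩
  rw [h0, zero_sub, abs_neg, abs_of_nonneg ht.1] at ha
  rw [h1, abs_sub_comm, abs_of_nonneg (sub_nonneg.2 ht.2), dist_comm] at hb
  have hyp := hX (γ t) a b e
  unfold gromovProd at hyp ⊢
  rcases min_choice ((dist a (γ t) + dist e (γ t) - dist a e) / 2)
    ((dist b (γ t) + dist e (γ t) - dist b e) / 2) with hm | hm <;>
  · rw [hm] at hyp
    linarith

theorem Mfun_le_M'fun {Y X : Type*} [MetricSpace Y] [MetricSpace X] {δ : ℝ}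
    (hY : IsDeltaHyperbolic Y δ) (f : Y → X) (e : Y) (N : ℝ) :
    Mfun f e (N - 2 * δ) ≤ M'fun f e N := by
  refine le_sInf ?_
  rintro _ ⟨x, y, ⟨γY, hγY, hN⟩, γX, hγX, rfl⟩
  obtain ⟨t, ht, hle⟩ := hY.exists_dist_le hγY e
  have hNt := hN t ht
  have hM : Mfun f e (N - 2 * δ) ≤ ENNReal.ofReal (gromovProd (f e) (f x) (f y)) :=
    sInf_le ⟨x, y, by linarith, rfl⟩
  refine hM.trans (Metric.le_infEDist.2 ?_)
  rintro _ ⟨s, hs, rfl⟩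
  rw [edist_dist]
  exact ENNReal.ofReal_le_ofReal (gromovProd_le_dist hγX (f e) hs)

theorem M'fun_sub_le_Mfun {Y X : Type*} [MetricSpace Y] [MetricSpace X] {δ : ℝ}
    (hgeoY : IsGeodesicSpace Y) (hgeoX : IsGeodesicSpace X)
    (hX : IsDeltaHyperbolic X δ) (f : Y → X) (e : Y) (N : ℝ) :
    M'fun f e N - ENNReal.ofReal (2 * δ) ≤ Mfun f e N := by
  refine le_sInf ?_
  rintro _ ⟨x, y, hN, rfl⟩
  obtain ⟨γY, hγY⟩ := hgeoY x y
  obtain ⟨γX, hγX⟩ := hgeoX (f x) (f y)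
  obtain ⟨t, ht, hle⟩ := hX.exists_dist_le hγX (f e)
  rw [tsub_le_iff_right]
  calc M'fun f e N
      ≤ Metric.infEDist (f e) (γX '' Set.Icc (0 : ℝ) (dist (f x) (f y))) :=
        sInf_le ⟨x, y, ⟨γY, hγY, fun s hs => hN.trans (gromovProd_le_dist hγY e hs)⟩,
          γX, hγX, rfl⟩
    _ ≤ edist (f e) (γX t) := Metric.infEDist_le_edist_of_mem ⟨t, ht, rfl⟩
    _ = ENNReal.ofReal (dist (f e) (γX t)) := edist_dist _ _
    _ ≤ ENNReal.ofReal (gromovProd (f e) (f x) (f y) + 2 * δ) := ENNReal.ofReal_le_ofReal hle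
    _ ≤ _ := ENNReal.ofReal_add_le

theorem stmt1 {Y X : Type*} [MetricSpace Y] [MetricSpace X]
    [ProperSpace Y] [ProperSpace X]
    (hgeoY : IsGeodesicSpace Y) (hgeoX : IsGeodesicSpace X)
    (δY δX : ℝ) (hδY : 0 ≤ δY) (hδX : 0 ≤ δX)
    (hhypY : IsDeltaHyperbolic Y δY) (hhypX : IsDeltaHyperbolic X δX)
    (f : Y → X) (e : Y) (hf : MetricallyProper f e) :
    Tendsto (Mfun f e) atTop (nhds ⊤) ↔ Tendsto (M'fun f e) atTop (nhds ⊤) := by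
  constructor
  · intro h
    exact tendsto_nhds_top_mono'
      (h.comp (tendsto_atTop_add_const_right atTop (-(2 * δY)) tendsto_id))
      fun N => Mfun_le_M'fun hhypY f e N
  · intro h
    have hsub := ENNReal.Tendsto.sub h
      (tendsto_const_nhds (x := ENNReal.ofReal (2 * δX))) (Or.inr ENNReal.ofReal_ne_top)
    rw [ENNReal.top_sub ENNReal.ofReal_ne_top] at hsub
    exact tendsto_nhds_top_mono' hsub fun N => M'fun_sub_le_Mfun hgeoY hgeoX hhypX f e N
end

section
/- Let k ≥ 1 and let G_k and H_k be as in the context, with t the generator of the ℤ-factor of G_k. For every g ∈ G_k there is at most one integer j such that g t^j ∈ H_k; that is, if g t^{j₁} ∈ H_k and g t^{j₂} ∈ H_k for integers j₁, j₂, then j₁ = j₂. -/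
/-- The hydra group `G_k = F(a_1,…,a_k) ⋊_φ ℤ`, built as a semidirect product in which
the generator `t` of the `ℤ`-factor satisfies `t⁻¹ a t = φ a` for `a ∈ F`
(so conjugation by `t` on the left acts by `φ⁻¹`). -/
abbrev HydraGroup (k : ℕ) (φ : MulAut (FreeGroup (Fin k))) :=
  SemidirectProduct (FreeGroup (Fin k)) (Multiplicative ℤ)
    (zpowersHom (MulAut (FreeGroup (Fin k))) φ⁻¹)

namespace HNNExtension

open NormalWord

variable {G : Type*} [Group G] {A B : Subgroup G} {φ : A ≃* B}

/-- The subgroup generated by a subgroup `H` of the base group and the stable letter. -/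
def closureInsertStable (φ : A ≃* B) (H : Subgroup G) : Subgroup (HNNExtension G A B φ) :=
  Subgroup.closure (of '' (H : Set G) ∪ {t})

theorem of_mem_closureInsertStable {H : Subgroup G} {h : G} (hh : h ∈ H) :
    (of h : HNNExtension G A B φ) ∈ closureInsertStable φ H :=
  Subgroup.subset_closure (Or.inl ⟨h, hh, rfl⟩)

theorem t_mem_closureInsertStable {H : Subgroup G} :
    (t : HNNExtension G A B φ) ∈ closureInsertStable φ H :=
  Subgroup.subset_closure (Or.inr rfl)

/-- If `H` meets both associated subgroups trivially, then the elements of the subgroup generated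
by `H` and the stable letter are represented by reduced words with all syllables in `H`. -/
theorem exists_reducedWord_of_mem_closureInsertStable {H : Subgroup G}
    (hA : ∀ x ∈ H, x ∈ A → x = 1) (hB : ∀ x ∈ H, x ∈ B → x = 1)
    {x : HNNExtension G A B φ} (hx : x ∈ closureInsertStable φ H) :
    ∃ w : ReducedWord G A B, w.prod φ = x ∧ w.head ∈ H ∧ ∀ p ∈ w.toList, p.2 ∈ H := by
  have hAB (u : ℤˣ) : ∀ x ∈ H, x ∈ toSubgroup A B u → x = 1 := by
    rcases Int.units_eq_one_or u with rfl | rfl <;> assumption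
  have cons_letter (u : ℤˣ) (y : HNNExtension G A B φ)
      (hy : ∃ w : ReducedWord G A B, w.prod φ = y ∧ w.head ∈ H ∧ ∀ p ∈ w.toList, p.2 ∈ H) :
      ∃ w : ReducedWord G A B, w.prod φ = t ^ (u : ℤ) * y ∧ w.head ∈ H ∧
        ∀ p ∈ w.toList, p.2 ∈ H := by
    obtain ⟨⟨g, l, hl⟩, rfl, hg, hlH⟩ := hy
    by_cases hc : ∀ p ∈ l.head?, g ∈ toSubgroup A B u → u = p.1
    · refine ⟨⟨1, (u, g) :: l, List.isChain_cons.2 ⟨hc, hl⟩⟩, ?_, H.one_mem, ?_⟩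
      · simp [ReducedWord.prod, mul_assoc]
      · simpa using ⟨hg, by simpa using hlH⟩
    · push Not at hc
      obtain ⟨⟨v, g'⟩, hp, hgu, huv⟩ := hc
      obtain rfl := hAB u g hg hgu
      rcases l with _ | ⟨p, l⟩
      · simp at hp
      · obtain rfl : p = (v, g') := by simpa using hp
        obtain rfl : v = -u := by
          rcases Int.units_eq_one_or u with rfl | rfl <;>
            rcases Int.units_eq_one_or v with rfl | rfl <;> simp_all
        refine ⟨⟨g', l, (List.isChain_cons.1 hl).2⟩, ?_, hlH (-u, g') (by simp),
          fun p hp => hlH p (by simp [hp])⟩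
        simp [ReducedWord.prod, mul_assoc]
  have mul_head (h : G) (hh : h ∈ H) (y : HNNExtension G A B φ)
      (hy : ∃ w : ReducedWord G A B, w.prod φ = y ∧ w.head ∈ H ∧ ∀ p ∈ w.toList, p.2 ∈ H) :
      ∃ w : ReducedWord G A B, w.prod φ = of h * y ∧ w.head ∈ H ∧ ∀ p ∈ w.toList, p.2 ∈ H := by
    obtain ⟨⟨g, l, hl⟩, rfl, hg, hlH⟩ := hy
    exact ⟨⟨h * g, l, hl⟩, by simp [ReducedWord.prod, mul_assoc], H.mul_mem hh hg, hlH⟩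
  unfold closureInsertStable at hx
  induction hx using Subgroup.closure_induction_left with
  | one => exact ⟨ReducedWord.empty G A B, by simp [ReducedWord.prod], H.one_mem, by simp⟩
  | mul_left x hx y _ ih =>
    rcases hx with ⟨h, hh, rfl⟩ | rfl
    · exact mul_head h hh y ih
    · simpa using cons_letter 1 y ih
  | inv_mul_cancel x hx y _ ih =>
    rcases hx with ⟨h, hh, rfl⟩ | rfl
    · simpa using mul_head h⁻¹ (H.inv_mem hh) y ih
    · simpa using cons_letter (-1) y ih

theorem mem_of_of_mem_closureInsertStable {H : Subgroup G}
    (hA : ∀ x ∈ H, x ∈ A → x = 1) (hB : ∀ x ∈ H, x ∈ B → x = 1)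
    {g : G} (hg : of g ∈ closureInsertStable φ H) : g ∈ H := by
  obtain ⟨w, hw, hh, -⟩ := exists_reducedWord_of_mem_closureInsertStable hA hB hg
  have hnil := ReducedWord.toList_eq_nil_of_mem_of_range φ w ⟨g, hw.symm⟩
  have : w.head = g := of_injective (φ := φ) (by simpa [ReducedWord.prod, hnil] using hw)
  exact this ▸ hh

theorem exists_mem_of_prod_mem_closureInsertStable {H : Subgroup G}
    (hA : ∀ x ∈ H, x ∈ A → x = 1) (hB : ∀ x ∈ H, x ∈ B → x = 1)
    (w : ReducedWord G A B) (hw : w.prod φ ∈ closureInsertStable φ H) :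
    ∃ h ∈ H, ∀ u ∈ w.toList.head?.map Prod.fst, w.head⁻¹ * h ∈ toSubgroup A B (-u) := by
  obtain ⟨w', hw', hh, -⟩ := exists_reducedWord_of_mem_closureInsertStable hA hB hw
  exact ⟨w'.head, hh, (ReducedWord.map_fst_eq_and_of_prod_eq φ hw'.symm).2⟩

end HNNExtension

/-- An isomorphism between two infinite cyclic subgroups matching given generators. -/
noncomputable def infiniteCyclicEquiv {K : Type*} [Group K] {d t : K}
    (hd : Function.Injective (zpowersHom K d)) (ht : Function.Injective (zpowersHom K t)) :
    (zpowersHom K d).range ≃* (zpowersHom K t).range :=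
  (MonoidHom.ofInjective hd).symm.trans (MonoidHom.ofInjective ht)

theorem infiniteCyclicEquiv_apply {K : Type*} [Group K] {d t : K}
    (hd : Function.Injective (zpowersHom K d)) (ht : Function.Injective (zpowersHom K t)) (n : ℤ)
    (h : d ^ n ∈ (zpowersHom K d).range) :
    (infiniteCyclicEquiv hd ht ⟨d ^ n, h⟩ : K) = t ^ n := by
  have : (⟨d ^ n, h⟩ : (zpowersHom K d).range) =
      MonoidHom.ofInjective hd (Multiplicative.ofAdd n) := by
    ext; simp [MonoidHom.ofInjective_apply]
  simp [infiniteCyclicEquiv, this, MonoidHom.ofInjective_apply]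

theorem zpowersHom_injective_of_forall {K : Type*} [Group K] {t : K}
    (h : ∀ n : ℤ, t ^ n = 1 → n = 0) : Function.Injective (zpowersHom K t) := by
  rw [injective_iff_map_eq_one]
  intro n hn
  exact congrArg Multiplicative.ofAdd (h n.toAdd (by simpa using hn))

/-- A subgroup containing no `d⁻¹ ^ (q + 1) * t⁻¹ ^ m` contains no nontrivial power of `d`. -/
theorem zpow_mem_eq_zero_of_notMem {K : Type*} [Group K] {d t : K} {H : Subgroup K}
    (hd : ∀ m q : ℕ, d⁻¹ ^ (q + 1) * t⁻¹ ^ m ∉ H) (n : ℤ) (hn : d ^ n ∈ H) : n = 0 := by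
  by_contra h0
  obtain ⟨q, hq⟩ : ∃ q : ℕ, n.natAbs = q + 1 := ⟨n.natAbs - 1, by omega⟩
  apply hd 0 q
  rw [pow_zero, mul_one, inv_pow, H.inv_mem_iff]
  rcases Int.natAbs_eq n with h | h
  · rwa [h, hq, zpow_natCast] at hn
  · rwa [h, hq, zpow_neg, H.inv_mem_iff, zpow_natCast] at hn

namespace HNNExtension

open NormalWord

variable {K : Type*} [Group K] {d s : K} {H : Subgroup K}
  {φ : (zpowersHom K d).range ≃* (zpowersHom K s).range}

theorem exists_positiveWord (r m : ℕ) :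
    ∃ (g : K) (l : List (ℤˣ × K)), (∀ p ∈ l, p.1 = 1) ∧
      (of s⁻¹ * (of s⁻¹ * t * of s⁻¹) ^ r * of s⁻¹ ^ m : HNNExtension K _ _ φ) =
        of g * (l.map fun x => t ^ (x.1 : ℤ) * of x.2).prod := by
  induction r with
  | zero => exact ⟨s⁻¹ * s⁻¹ ^ m, [], by simp, by simp⟩
  | succ r ih =>
    obtain ⟨g, l, hl, h⟩ := ih
    refine ⟨s⁻¹ * s⁻¹, (1, g) :: l, by simpa using hl, ?_⟩
    rw [List.map_cons, List.prod_cons, mul_assoc (t ^ _), ← h, pow_succ']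
    simp [mul_assoc]

/-- If `of x * t * y` lies in the subgroup generated by `H` and the stable letter, where `y` is a
positive word, then a power of the stable conjugate can be passed through the first letter. -/
theorem exists_zpow_mem_of_positiveWord
    (hφ : ∀ n : ℤ, (t * of (d ^ n) : HNNExtension K _ _ φ) = of (s ^ n) * t)
    (hs : ∀ n : ℤ, s ^ n ∈ H → n = 0) (hd : ∀ m q : ℕ, d⁻¹ ^ (q + 1) * s⁻¹ ^ m ∉ H)
    (x : K) (r m : ℕ)
    (h : (of x * t * (of s⁻¹ * (of s⁻¹ * t * of s⁻¹) ^ r * of s⁻¹ ^ m) : HNNExtension K _ _ φ) ∈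
      closureInsertStable φ H) :
    ∃ f : ℤ, x * s ^ f ∈ H ∧
      (of (d ^ (-f)) * (of s⁻¹ * (of s⁻¹ * t * of s⁻¹) ^ r * of s⁻¹ ^ m) :
        HNNExtension K _ _ φ) ∈ closureInsertStable φ H := by
  have hA : ∀ x ∈ H, x ∈ (zpowersHom K d).range → x = 1 := by
    rintro _ hx ⟨n, rfl⟩
    have := zpow_mem_eq_zero_of_notMem hd n.toAdd (by simpa using hx)
    simp [this]
  have hB : ∀ x ∈ H, x ∈ (zpowersHom K s).range → x = 1 := by
    rintro _ hx ⟨n, rfl⟩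
    have := hs n.toAdd (by simpa using hx)
    simp [this]
  obtain ⟨g, l, hl, hgl⟩ := exists_positiveWord (φ := φ) r m
  have hchain : ((1, g) :: l).IsChain
      (fun a b => a.2 ∈ toSubgroup (zpowersHom K d).range (zpowersHom K s).range a.1 →
        a.1 = b.1) := by
    have hpos : ∀ p ∈ (1, g) :: l, p.1 = 1 := by simpa using hl
    refine List.Pairwise.isChain (List.pairwise_of_forall_mem_list ?_)
    intro a ha b hb _
    rw [hpos a ha, hpos b hb]
  obtain ⟨h', hh', hu⟩ := exists_mem_of_prod_mem_closureInsertStable hA hB (φ := φ)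
    ⟨x, (1, g) :: l, hchain⟩ (by
      rw [hgl] at h
      simpa [ReducedWord.prod, mul_assoc] using h)
  obtain ⟨n, hn⟩ := hu 1 (by simp)
  obtain rfl : h' = x * s ^ n.toAdd := by
    rw [← mul_inv_cancel_left x h', ← hn]; simp
  refine ⟨n.toAdd, hh', ?_⟩
  have := mul_mem (inv_mem (mul_mem (of_mem_closureInsertStable (φ := φ) hh')
    t_mem_closureInsertStable)) h
  convert this using 1
  rw [map_mul, mul_assoc (of x), ← hφ]
  simp [mul_assoc]

theorem notMem_closureInsertStable_of_pos
    (hφ : ∀ n : ℤ, (t * of (d ^ n) : HNNExtension K _ _ φ) = of (s ^ n) * t)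
    (hs : ∀ n : ℤ, s ^ n ∈ H → n = 0) (hd : ∀ m q : ℕ, d⁻¹ ^ (q + 1) * s⁻¹ ^ m ∉ H)
    (hmem : ∀ g : K, (of g : HNNExtension K _ _ φ) ∈ closureInsertStable φ H → g ∈ H)
    (r m e : ℕ) :
    (of (d⁻¹ ^ (e + 1)) * (of s⁻¹ * (of s⁻¹ * t * of s⁻¹) ^ r * of s⁻¹ ^ m) :
      HNNExtension K _ _ φ) ∉ closureInsertStable φ H := by
  induction r generalizing e with
  | zero =>
    intro h
    apply hd (m + 1) e
    apply hmem
    convert h using 1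
    simp [pow_succ']
  | succ r ih =>
    intro h
    obtain ⟨f, hf, hf'⟩ := exists_zpow_mem_of_positiveWord hφ hs hd
      (d⁻¹ ^ (e + 1) * s⁻¹ ^ 2) r m (by
        convert h using 1
        simp [pow_succ' _ r, pow_two, mul_assoc])
    have hlt : 2 < f := by
      by_contra! hle
      apply hd (2 - f).toNat e
      convert hf using 1
      rw [mul_assoc]
      congr 1
      rw [← zpow_natCast, Int.toNat_of_nonneg (by omega), ← zpow_natCast, inv_zpow', inv_zpow',
        ← zpow_add]
      congr 1
      push_cast
      ring
    obtain ⟨e', rfl⟩ : ∃ e' : ℕ, f = ((e' + 1 : ℕ) : ℤ) := ⟨(f - 1).toNat, by omega⟩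
    apply ih e'
    rwa [← zpow_natCast, inv_zpow']

theorem stable_notMem_closureInsertStable
    (hφ : ∀ n : ℤ, (t * of (d ^ n) : HNNExtension K _ _ φ) = of (s ^ n) * t)
    (hs : ∀ n : ℤ, s ^ n ∈ H → n = 0) (hd : ∀ m q : ℕ, d⁻¹ ^ (q + 1) * s⁻¹ ^ m ∉ H)
    (hmem : ∀ g : K, (of g : HNNExtension K _ _ φ) ∈ closureInsertStable φ H → g ∈ H)
    (m q : ℕ) :
    ((of s * t⁻¹ * of s)⁻¹ ^ (q + 1) * (of s)⁻¹ ^ m : HNNExtension K _ _ φ) ∉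
      closureInsertStable φ H := by
  intro h
  obtain ⟨f, hf, hf'⟩ := exists_zpow_mem_of_positiveWord hφ hs hd s⁻¹ q m (by
    convert h using 1
    simp [pow_succ', mul_assoc])
  obtain rfl : f = 1 := by
    have := hs (-1 + f) (by rwa [zpow_add, zpow_neg_one])
    omega
  exact notMem_closureInsertStable_of_pos hφ hs hd hmem q m 0 (by simpa using hf')

end HNNExtension

/-- The elements of the hydra group, in terms of `t` and `b i = a i * t`, to which the `b i`
conjugate `t`: they satisfy `d i = a (i - 1)⁻¹ * t`. -/
def hydraConj {K : Type*} [Group K] (t : K) (b : ℕ → K) : ℕ → K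
  | 0 => t
  | n + 1 => t * (b n)⁻¹ * t

open HNNExtension in
/-- A quotient of the hydra group, built as an iterated HNN extension, in which the subgroup
generated by the `b i` has trivial intersection with the powers of `t`. -/
theorem exists_hydra_tower (k : ℕ) :
    ∃ (K : Type) (_ : Group K) (s : K) (b : ℕ → K),
      (∀ i < k, s * b i = b i * hydraConj s b i) ∧
      (∀ n : ℤ, s ^ n ∈ Subgroup.closure (b '' Set.Iio k) → n = 0) ∧
      ∀ m q : ℕ, (hydraConj s b k)⁻¹ ^ (q + 1) * s⁻¹ ^ m ∉ Subgroup.closure (b '' Set.Iio k) := by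
  induction k with
  | zero =>
    have hinj (n : ℤ) (hn : (Multiplicative.ofAdd (1 : ℤ)) ^ n = 1) : n = 0 := by
      simpa [← ofAdd_zsmul] using hn
    refine ⟨Multiplicative ℤ, inferInstance, Multiplicative.ofAdd 1, 1, by simp,
      fun n hn => hinj n (by simpa using hn), fun m q hmq => ?_⟩
    have := hinj (-(q + 1 + m : ℕ)) (by
      rw [zpow_neg, zpow_natCast, ← inv_pow, pow_add]
      simpa [hydraConj] using hmq)
    omega
  | succ k ih =>
    obtain ⟨K, _, s, b, hrel, hs, hd⟩ := ih
    set d := hydraConj s b k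
    set H := Subgroup.closure (b '' Set.Iio k)
    have hsinj := zpowersHom_injective_of_forall (t := s) fun n hn => hs n (hn ▸ H.one_mem)
    have hdinj := zpowersHom_injective_of_forall (t := d) fun n hn =>
      zpow_mem_eq_zero_of_notMem hd n (hn ▸ H.one_mem)
    let φ := infiniteCyclicEquiv hdinj hsinj
    have hφ (n : ℤ) : (t * of (d ^ n) : HNNExtension K _ _ φ) = of (s ^ n) * t := by
      have hdn : d ^ n ∈ (zpowersHom K d).range := ⟨Multiplicative.ofAdd n, by simp⟩
      rw [← infiniteCyclicEquiv_apply hdinj hsinj n hdn]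
      exact t_mul_of (φ := φ) ⟨d ^ n, hdn⟩
    have hmem (g : K) : (of g : HNNExtension K _ _ φ) ∈ closureInsertStable φ H → g ∈ H := by
      refine mem_of_of_mem_closureInsertStable ?_ ?_
      · rintro _ hx ⟨n, rfl⟩
        simp [zpow_mem_eq_zero_of_notMem hd n.toAdd (by simpa using hx)]
      · rintro _ hx ⟨n, rfl⟩
        simp [hs n.toAdd (by simpa using hx)]
    let b' : ℕ → HNNExtension K _ _ φ := fun i => if i < k then of (b i) else t
    have hconj : ∀ i ≤ k, hydraConj (of s) b' i = of (hydraConj s b i) := by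
      rintro (_ | i) hi
      · rfl
      · simp [hydraConj, b', Nat.lt_of_succ_le hi]
    have hle : Subgroup.closure (b' '' Set.Iio (k + 1)) ≤ closureInsertStable φ H := by
      rw [Subgroup.closure_le]
      rintro _ ⟨i, -, rfl⟩
      by_cases hi : i < k
      · simpa [b', hi] using
          of_mem_closureInsertStable (φ := φ) (Subgroup.subset_closure ⟨i, hi, rfl⟩ : b i ∈ H)
      · simpa [b', hi] using t_mem_closureInsertStable
    refine ⟨HNNExtension K _ _ φ, inferInstance, of s, b', ?_, ?_, ?_⟩
    · intro i hi
      rw [hconj i (by omega)]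
      by_cases hik : i < k
      · simp only [b', if_pos hik, ← map_mul, hrel i hik]
      · obtain rfl : i = k := by omega
        simpa [b'] using (hφ 1).symm
    · intro n hn
      exact hs n (hmem _ (by simpa using hle hn))
    · intro m q hmq
      refine stable_notMem_closureInsertStable hφ hs hd hmem m q (hle ?_)
      simpa [hydraConj, b'] using hmq

/-- A homomorphism intertwining two automorphisms intertwines their powers. -/
theorem MonoidHom.comp_mulAut_zpow {F K : Type*} [Group F] [Group K] (f : F →* K)
    (α : MulAut F) (β : MulAut K) (h : ∀ x, f (α x) = β (f x)) (n : ℤ) (x : F) :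
    f ((α ^ n) x) = (β ^ n) (f x) := by
  have hinv (x : F) : f (α⁻¹ x) = β⁻¹ (f x) := by
    apply β.injective
    rw [← h]
    simp
  induction n generalizing x with
  | zero => simp
  | succ n ih => rw [zpow_add_one, zpow_add_one, MulAut.mul_apply, MulAut.mul_apply, ih, h]
  | pred n ih => rw [zpow_sub_one, zpow_sub_one, MulAut.mul_apply, MulAut.mul_apply, ih, hinv]

theorem stmt4 (k : ℕ) (hk : 1 ≤ k)
    (φ : MulAut (FreeGroup (Fin k)))
    -- `φ` is the hydra automorphism: `φ a₁ = a₁` and `φ aᵢ = aᵢ aᵢ₋₁` for `i > 1`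
    -- (here generators are indexed by `Fin k`, i.e. `0`-indexed).
    (hφ : ∀ i : Fin k, φ (FreeGroup.of i) =
      if (i : ℕ) = 0 then FreeGroup.of i
      else FreeGroup.of i *
        FreeGroup.of ⟨(i : ℕ) - 1, lt_of_le_of_lt (Nat.sub_le _ _) i.isLt⟩)
    (t : HydraGroup k φ) (ht : t = SemidirectProduct.inr (Multiplicative.ofAdd 1))
    (Hk : Subgroup (HydraGroup k φ))
    -- `H_k` is the subgroup generated by `a₁ t, …, a_k t`.
    (hHk : Hk = Subgroup.closure
      (Set.range fun i : Fin k => SemidirectProduct.inl (FreeGroup.of i) * t))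
    (g : HydraGroup k φ) (j₁ j₂ : ℤ)
    (h₁ : g * t ^ j₁ ∈ Hk) (h₂ : g * t ^ j₂ ∈ Hk) :
    j₁ = j₂ := by
  subst ht hHk
  obtain ⟨K, _, s, b, hrel, hs, -⟩ := exists_hydra_tower k
  let f : FreeGroup (Fin k) →* K := FreeGroup.lift fun i => b i * s⁻¹
  have hf (x : FreeGroup (Fin k)) : f (φ x) = s⁻¹ * f x * s := by
    have : f.comp φ.toMonoidHom = (MulAut.conj s⁻¹).toMonoidHom.comp f := by
      ext ⟨i, hi⟩
      have hr := hrel i hi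
      rcases i with _ | i
      · have hr' : s * b 0 = b 0 * s := hr
        simp [f, hφ, eq_inv_mul_iff_mul_eq, ← mul_assoc, hr']
      · have hr' : s * b (i + 1) * (s⁻¹ * b i * s⁻¹) = b (i + 1) := by
          rw [hr]; simp [hydraConj, mul_assoc]
        simpa [f, hφ, eq_inv_mul_iff_mul_eq, mul_assoc] using hr'
    simpa using DFunLike.congr_fun this x
  have hf' (x : FreeGroup (Fin k)) : f (φ⁻¹ x) = MulAut.conj s (f x) := by
    have := hf (φ⁻¹ x)
    rw [MulAut.apply_inv_self] at this
    simp [this, mul_assoc]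
  let Φ : HydraGroup k φ →* K := SemidirectProduct.lift f (zpowersHom K s) fun n => by
    ext i
    simpa using f.comp_mulAut_zpow φ⁻¹ (MulAut.conj s) hf' n.toAdd (FreeGroup.of i)
  have hle : Subgroup.closure (Set.range fun i : Fin k =>
      (SemidirectProduct.inl (FreeGroup.of i) : HydraGroup k φ) *
        SemidirectProduct.inr (Multiplicative.ofAdd 1)) ≤
      (Subgroup.closure (b '' Set.Iio k)).comap Φ := by
    rw [Subgroup.closure_le]
    rintro _ ⟨i, rfl⟩
    exact Subgroup.subset_closure ⟨i, i.isLt, by simp [Φ, f]⟩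
  have hmem := hle (mul_mem (inv_mem h₁) h₂)
  have := hs (-j₁ + j₂) (by
    rw [zpow_add, zpow_neg]
    simpa [Φ, mul_assoc] using hmem)
  omega
end

section
/- Let k ≥ 1 and let G_k and H_k be as in the context. Every element of G_k = F ⋊_φ ℤ is uniquely of the form (w, n) with w ∈ F and n ∈ ℤ (i.e., has normal form w t^n). If g₁ = (w, n₁) and g₂ = (w, n₂) are elements of H_k with the same free-group component w ∈ F, then g₁ = g₂ (equivalently n₁ = n₂). -/
/-- The Ackermann-type functions recording how the generators act on the orbit
`{t⁻ⁿ | n ∈ ℕ}` in the space of cosets of `H_k`: `H_k t⁻ⁿ aᵢ = H_k t⁻ᵐ` with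
`m = hydraFun i n` (generators `0`-indexed). -/
def hydraFun : ℕ → ℕ → ℕ
  | 0, n => n + 1
  | _ + 1, 0 => 1
  | i + 1, n + 1 => hydraFun i (hydraFun (i + 1) n) + 1

theorem hydraFun_zero_right (i : ℕ) : hydraFun i 0 = 1 := by
  cases i <;> simp [hydraFun]

theorem hydraFun_strictMono (i : ℕ) : StrictMono (hydraFun i) := by
  induction i with
  | zero => exact fun a b h => by simpa [hydraFun] using h
  | succ i ih =>
    refine strictMono_nat_of_lt_succ fun n => ?_
    rw [hydraFun]
    exact Nat.lt_succ_of_le (ih.le_apply)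

/-- An injection `ℕ → ℕ` extends to a permutation of `ℕ ⊕ ℕ`. -/
theorem exists_perm_extending_injective {f : ℕ → ℕ} (hf : Function.Injective f) :
    ∃ e : Equiv.Perm (ℕ ⊕ ℕ), ∀ n, e (Sum.inl n) = Sum.inl (f n) := by
  let p : ℕ ↪ ℕ ⊕ ℕ := ⟨Sum.inl, Sum.inl_injective⟩
  let q : ℕ ↪ ℕ ⊕ ℕ := ⟨fun n => Sum.inl (f n), Sum.inl_injective.comp hf⟩
  let g : Set.range p ↪ ℕ ⊕ ℕ := (Equiv.ofInjective p p.injective).symm.toEmbedding.trans q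
  have hp : Infinite ((Set.range p)ᶜ : Set (ℕ ⊕ ℕ)) :=
    Infinite.of_injective (fun n : ℕ => ⟨Sum.inr n, by simp [p]⟩) fun a b h => by simpa using h
  have hg : Infinite ((Set.range g)ᶜ : Set (ℕ ⊕ ℕ)) :=
    Infinite.of_injective (fun n : ℕ => ⟨Sum.inr n, by simp [g, q]⟩) fun a b h => by simpa using h
  obtain ⟨e, he⟩ := Cardinal.extend_function g nonempty_equiv_of_countable
  refine ⟨e, fun n => ?_⟩
  have h := he ⟨p n, n, rfl⟩
  simpa [g, q, p] using h

/-- The right action of a free group on `Y` in which each generator acts by a given permutation. -/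
def freeRightAct {ι Y : Type*} (e : ι → Equiv.Perm Y) : FreeGroup ι →* (Equiv.Perm Y)ᵐᵒᵖ :=
  FreeGroup.lift fun i => MulOpposite.op (e i)

section

variable {k : ℕ} {φ : MulAut (FreeGroup (Fin k))} {e : Fin k → Equiv.Perm (ℕ ⊕ ℕ)}

/-- The coset of `t⁻ᴺ⁻ⁿ` is carried by `φ⁻ᴺ(aᵢ)` to that of `t⁻ᴺ⁻ᵐ`, where `m = hydraFun i n`. -/
theorem freeRightAct_pow_inv_of
    (hφ : ∀ i : Fin k, φ (FreeGroup.of i) =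
      if (i : ℕ) = 0 then FreeGroup.of i
      else FreeGroup.of i *
        FreeGroup.of ⟨(i : ℕ) - 1, lt_of_le_of_lt (Nat.sub_le _ _) i.isLt⟩)
    (he : ∀ i n, e i (Sum.inl n) = Sum.inl (hydraFun i n)) (N : ℕ) (i : Fin k) (n : ℕ) :
    (freeRightAct e ((φ⁻¹ ^ N) (FreeGroup.of i))).unop (Sum.inl (n + N)) =
      Sum.inl (hydraFun i n + N) := by
  induction N generalizing i n with
  | zero => simp [freeRightAct, he]
  | succ N ih =>
    obtain ⟨i, hi⟩ := i
    induction i generalizing n with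
    | zero =>
      have h : φ⁻¹ (FreeGroup.of ⟨0, hi⟩) = FreeGroup.of ⟨0, hi⟩ := by
        rw [MulAut.inv_apply, MulEquiv.symm_apply_eq, hφ]; simp
      rw [pow_succ, MulAut.mul_apply, h, show n + (N + 1) = n + 1 + N by omega, ih]
      simp only [hydraFun, Sum.inl.injEq]; omega
    | succ i ihi =>
      have hi' : i < k := by omega
      have h : φ⁻¹ (FreeGroup.of ⟨i + 1, hi⟩) * φ⁻¹ (FreeGroup.of ⟨i, hi'⟩) =
          FreeGroup.of ⟨i + 1, hi⟩ := by
        rw [← map_mul, MulAut.inv_apply, MulEquiv.symm_apply_eq, hφ]; simp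
      have h' := congrArg (fun x => (freeRightAct e ((φ⁻¹ ^ N) x)).unop (Sum.inl (n + 1 + N))) h
      simp only [map_mul, MulOpposite.unop_mul, Equiv.Perm.mul_apply, ih,
        ← MulAut.mul_apply, ← pow_succ] at h'
      have h'' := ihi (hydraFun (i + 1) n) hi'
      apply (freeRightAct e ((φ⁻¹ ^ (N + 1)) (FreeGroup.of ⟨i, hi'⟩))).unop.injective
      rw [h'', show n + (N + 1) = n + 1 + N by omega, h', hydraFun]
      simp only [Sum.inl.injEq]; omega

/-- An element `w tⁿ` of `H_k` satisfies `H_k t⁻ᴺ φ⁻ᴺ(w) = H_k t⁻ᴺ⁻ⁿ` for large `N`. -/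
theorem eventually_freeRightAct_left
    (hφ : ∀ i : Fin k, φ (FreeGroup.of i) =
      if (i : ℕ) = 0 then FreeGroup.of i
      else FreeGroup.of i *
        FreeGroup.of ⟨(i : ℕ) - 1, lt_of_le_of_lt (Nat.sub_le _ _) i.isLt⟩)
    (he : ∀ i n, e i (Sum.inl n) = Sum.inl (hydraFun i n)) {g : HydraGroup k φ}
    (hg : g ∈ Subgroup.closure (Set.range fun i : Fin k =>
      (SemidirectProduct.inl (FreeGroup.of i) *
        SemidirectProduct.inr (Multiplicative.ofAdd 1) : HydraGroup k φ))) :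
    ∃ N₀ : ℕ, ∀ N ≥ N₀, ∀ M : ℕ, (M : ℤ) = N + g.right.toAdd →
      (freeRightAct e ((φ⁻¹ ^ (N : ℤ)) g.left)).unop (Sum.inl N) = Sum.inl M := by
  induction hg using Subgroup.closure_induction with
  | mem x hx =>
    obtain ⟨i, rfl⟩ := hx
    refine ⟨0, fun N _ M hM => ?_⟩
    have h := freeRightAct_pow_inv_of hφ he N i 0
    rw [hydraFun_zero_right, zero_add] at h
    simp only [SemidirectProduct.mul_right, SemidirectProduct.right_inl,
      SemidirectProduct.right_inr, one_mul, toAdd_ofAdd] at hM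
    obtain rfl : M = 1 + N := by omega
    simpa using h
  | one =>
    refine ⟨0, fun N _ M hM => ?_⟩
    simp only [SemidirectProduct.one_right, toAdd_one, add_zero, Nat.cast_inj] at hM
    simp [hM]
  | mul x y _ _ hx hy =>
    obtain ⟨N₁, h₁⟩ := hx
    obtain ⟨N₂, h₂⟩ := hy
    refine ⟨N₁ + N₂ + x.right.toAdd.natAbs, fun N hN M hM => ?_⟩
    obtain ⟨K, hK⟩ := Int.eq_ofNat_of_zero_le (a := N + x.right.toAdd) (by omega)
    simp only [SemidirectProduct.mul_right, toAdd_mul] at hM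
    have hx := h₁ N (by omega) K hK.symm
    have hy := h₂ K (by omega) M (by omega)
    rw [← hK, zpow_add, MulAut.mul_apply] at hy
    rw [SemidirectProduct.mul_left, map_mul, map_mul, MulOpposite.unop_mul,
      Equiv.Perm.mul_apply, hx]
    exact hy
  | inv x _ hx =>
    obtain ⟨N₁, h₁⟩ := hx
    refine ⟨N₁ + x.right.toAdd.natAbs, fun N hN M hM => ?_⟩
    simp only [SemidirectProduct.inv_right, toAdd_inv] at hM
    have hx := h₁ M (by omega) N (by omega)
    rw [hM, zpow_add, MulAut.mul_apply] at hx
    rw [SemidirectProduct.inv_left, map_inv, map_inv, map_inv, MulOpposite.unop_inv,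
      Equiv.Perm.inv_eq_iff_eq]
    exact hx.symm

end

theorem stmt5 (k : ℕ) (hk : 1 ≤ k)
    (φ : MulAut (FreeGroup (Fin k)))
    -- `φ` is the hydra automorphism: `φ a₁ = a₁` and `φ aᵢ = aᵢ aᵢ₋₁` for `i > 1`
    -- (here generators are indexed by `Fin k`, i.e. `0`-indexed).
    (hφ : ∀ i : Fin k, φ (FreeGroup.of i) =
      if (i : ℕ) = 0 then FreeGroup.of i
      else FreeGroup.of i *
        FreeGroup.of ⟨(i : ℕ) - 1, lt_of_le_of_lt (Nat.sub_le _ _) i.isLt⟩)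
    (t : HydraGroup k φ) (ht : t = SemidirectProduct.inr (Multiplicative.ofAdd 1))
    (Hk : Subgroup (HydraGroup k φ))
    -- `H_k` is the subgroup generated by `a₁ t, …, a_k t`.
    (hHk : Hk = Subgroup.closure
      (Set.range fun i : Fin k => SemidirectProduct.inl (FreeGroup.of i) * t))
    -- If two elements of `H_k` have the same free-group component (`w` in the
    -- normal form `w tⁿ`), then they are equal.
    (g₁ g₂ : HydraGroup k φ) (hg₁ : g₁ ∈ Hk) (hg₂ : g₂ ∈ Hk)
    (hw : g₁.left = g₂.left) :
    g₁ = g₂ := by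
  subst ht hHk
  choose e he using fun i : Fin k =>
    exists_perm_extending_injective (hydraFun_strictMono i).injective
  obtain ⟨N₁, h₁⟩ := eventually_freeRightAct_left hφ he hg₁
  obtain ⟨N₂, h₂⟩ := eventually_freeRightAct_left hφ he hg₂
  let N := N₁ + N₂ + g₁.right.toAdd.natAbs + g₂.right.toAdd.natAbs
  obtain ⟨M₁, hM₁⟩ := Int.eq_ofNat_of_zero_le (a := N + g₁.right.toAdd) (by omega)
  obtain ⟨M₂, hM₂⟩ := Int.eq_ofNat_of_zero_le (a := N + g₂.right.toAdd) (by omega)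
  have e₁ := h₁ N (by omega) M₁ hM₁.symm
  have e₂ := h₂ N (by omega) M₂ hM₂.symm
  rw [hw, e₂, Sum.inl.injEq] at e₁
  refine SemidirectProduct.ext hw (Multiplicative.toAdd.injective ?_)
  omega
end

section
/- Let F be a finitely generated free group and let φ be any automorphism of F. Then the semidirect product F ⋊_φ ℤ is freely indecomposable: it is not isomorphic to a free product A * B of two nontrivial groups A and B. -/
/-- A nontrivial free group has a nontrivial homomorphism to the additive group of rationals. -/
theorem IsFreeGroup.exists_hom_rat_ne_one (A : Type*) [Group A] [IsFreeGroup A] [Nontrivial A] :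
    ∃ f : A →* Multiplicative ℚ, f ≠ 1 := by
  obtain ⟨x⟩ : Nonempty (IsFreeGroup.Generators A) := by
    by_contra hempty
    rw [not_nonempty_iff] at hempty
    have hid : MonoidHom.id A = 1 := IsFreeGroup.ext_hom fun x => hempty.elim x
    obtain ⟨a, ha⟩ := exists_ne (1 : A)
    exact ha (DFunLike.congr_fun hid a)
  refine ⟨IsFreeGroup.lift fun _ => Multiplicative.ofAdd 1, fun h => ?_⟩
  have hx := DFunLike.congr_fun h (IsFreeGroup.of x)
  rw [IsFreeGroup.lift_of, MonoidHom.one_apply, ofAdd_eq_one] at hx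
  exact one_ne_zero hx

/-- `2` is not an eigenvalue of an automorphism of a finitely generated group acting on its
rational characters. -/
theorem MulAut.eq_zero_of_forall_eq_two_mul {N : Type*} [Group N] [Group.FG N] (σ : MulAut N)
    (f : N →* Multiplicative ℚ) (hf : ∀ a, (f (σ a)).toAdd = 2 * (f a).toAdd) (a : N) :
    (f a).toAdd = 0 := by
  set L : Submodule ℤ ℚ := AddSubgroup.toIntSubmodule (MonoidHom.toAdditiveLeft f).range with hL
  have hmem : ∀ x, x ∈ L ↔ ∃ b, (f b).toAdd = x := fun x => Iff.rfl
  have hfg : L.FG := by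
    rw [Submodule.fg_iff_addSubgroup_fg, hL, AddSubgroup.toIntSubmodule_toAddSubgroup,
      ← AddGroup.fg_iff_addSubgroup_fg]
    infer_instance
  have hle : L ≤ Ideal.span {(2 : ℤ)} • L := by
    intro x hx
    obtain ⟨b, rfl⟩ := (hmem x).1 hx
    obtain ⟨c, rfl⟩ := σ.surjective b
    have : (f (σ c)).toAdd = (2 : ℤ) • (f c).toAdd := by rw [hf]; simp
    rw [this]
    exact Submodule.smul_mem_smul (Ideal.mem_span_singleton_self 2) ((hmem _).2 ⟨c, rfl⟩)
  obtain ⟨r, hr, hr0⟩ := Submodule.exists_sub_one_mem_and_smul_eq_zero_of_fg_of_le_smul _ _ hfg hle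
  have hrne : r ≠ 0 := by
    rintro rfl
    rw [Ideal.mem_span_singleton] at hr
    omega
  exact (smul_eq_zero.1 (hr0 _ ((hmem _).2 ⟨a, rfl⟩))).resolve_left hrne

namespace MappingTorus

variable {N : Type*} [Group N] (σ : MulAut N)

/-- The character of `N ⋊ ℤ` that is trivial on `N` and sends the generator of `ℤ` to `2`. -/
noncomputable def scale :
    SemidirectProduct N (Multiplicative ℤ) (zpowersHom (MulAut N) σ) →* ℚˣ :=
  (zpowersHom ℚˣ (Units.mk0 2 two_ne_zero)).comp SemidirectProduct.rightHom

theorem right_eq_one_of_scale_eq_one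
    {g : SemidirectProduct N (Multiplicative ℤ) (zpowersHom (MulAut N) σ)}
    (hg : scale σ g = 1) : g.right = 1 := by
  have h : (2 : ℚ) ^ g.right.toAdd = 1 := by
    simpa [scale, zpowersHom_apply, Units.ext_iff] using hg
  rw [zpow_eq_one_iff_right₀ (by norm_num) (by norm_num)] at h
  exact toAdd_eq_zero.1 h

/-- An affine action of `N ⋊ ℤ` on `ℚ` with linear part `scale σ` is trivial on the kernel of
`scale σ` when `N` is finitely generated. -/
theorem eq_one_of_scale_eq_one [Group.FG N]
    (h : SemidirectProduct N (Multiplicative ℤ) (zpowersHom (MulAut N) σ) →* Equiv.Perm ℚ)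
    (haff : ∀ g x, h g x = scale σ g * x + h g 0)
    {g : SemidirectProduct N (Multiplicative ℤ) (zpowersHom (MulAut N) σ)}
    (hg : scale σ g = 1) : h g = 1 := by
  have hinl : ∀ n : N, scale σ (SemidirectProduct.inl n) = 1 := fun n => by simp [scale]
  have htrans : ∀ n x, h (SemidirectProduct.inl n) x = x + h (SemidirectProduct.inl n) 0 := by
    intro n x
    rw [haff, hinl]
    simp
  let f : N →* Multiplicative ℚ :=
    { toFun := fun n => Multiplicative.ofAdd (h (SemidirectProduct.inl n) 0)
      map_one' := by simp
      map_mul' := fun a b => by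
        rw [← ofAdd_add, map_mul, map_mul, Equiv.Perm.mul_apply, htrans, add_comm] }
  have hf : ∀ a, (f (σ a)).toAdd = 2 * (f a).toAdd := by
    intro a
    change h (SemidirectProduct.inl (σ a)) 0 = 2 * h (SemidirectProduct.inl a) 0
    set t : SemidirectProduct N (Multiplicative ℤ) (zpowersHom (MulAut N) σ) :=
      SemidirectProduct.inr (Multiplicative.ofAdd 1)
    have hrel : SemidirectProduct.inl (σ a) * t = t * SemidirectProduct.inl a := by
      ext <;> simp [t]
    have hscale : ((scale σ t : ℚˣ) : ℚ) = 2 := by simp [scale, t]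
    have h0 := congrArg (fun p : Equiv.Perm ℚ => p 0) (congrArg h hrel)
    simp only [map_mul, Equiv.Perm.mul_apply] at h0
    rw [htrans, haff t (h (SemidirectProduct.inl a) 0), hscale] at h0
    linarith
  obtain ⟨n, m⟩ := g
  obtain rfl : m = 1 := right_eq_one_of_scale_eq_one σ hg
  ext x
  change h (SemidirectProduct.inl n) x = x
  rw [htrans, show h (SemidirectProduct.inl n) 0 = 0 from
    MulAut.eq_zero_of_forall_eq_two_mul σ f hf n, add_zero]

/-- An affine action of a free product is affine as soon as it is so on both factors. -/
theorem affine_of_coprod {A B : Type*} [Group A] [Group B] (χ : Monoid.Coprod A B →* ℚˣ)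
    (h : Monoid.Coprod A B →* Equiv.Perm ℚ)
    (hA : ∀ a x, h (Monoid.Coprod.inl a) x =
      χ (Monoid.Coprod.inl a) * x + h (Monoid.Coprod.inl a) 0)
    (hB : ∀ b x, h (Monoid.Coprod.inr b) x =
      χ (Monoid.Coprod.inr b) * x + h (Monoid.Coprod.inr b) 0)
    (g : Monoid.Coprod A B) : ∀ x, h g x = χ g * x + h g 0 := by
  induction g using Monoid.Coprod.induction_on with
  | inl a => exact hA a
  | inr b => exact hB b
  | mul u v hu hv =>
    intro x
    simp only [map_mul, Equiv.Perm.mul_apply, Units.val_mul]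
    rw [hu, hv, hu (h v 0)]
    ring

variable {A B : Type*} [Group A] [Group B] [Group.FG N]
  (e : SemidirectProduct N (Multiplicative ℤ) (zpowersHom (MulAut N) σ) ≃* Monoid.Coprod A B)

/-- An action of a free product isomorphic to `N ⋊ ℤ` that is affine on both factors with linear
part `scale σ` is trivial on the kernel of `scale σ`. -/
theorem eq_one_of_coprod_affine (h : Monoid.Coprod A B →* Equiv.Perm ℚ)
    (hA : ∀ a x, h (Monoid.Coprod.inl a) x =
      scale σ (e.symm (Monoid.Coprod.inl a)) * x + h (Monoid.Coprod.inl a) 0)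
    (hB : ∀ b x, h (Monoid.Coprod.inr b) x =
      scale σ (e.symm (Monoid.Coprod.inr b)) * x + h (Monoid.Coprod.inr b) 0)
    {g : Monoid.Coprod A B} (hg : scale σ (e.symm g) = 1) : h g = 1 := by
  have haff := affine_of_coprod ((scale σ).comp e.symm.toMonoidHom) h hA hB
  simpa using eq_one_of_scale_eq_one σ (h.comp e.toMonoidHom)
    (fun g x => by simpa using haff (e g) x) hg

/-- The linear action of a group on `ℚ` through a character. -/
def linearAction {H : Type*} [Group H] (χ : H →* ℚˣ) : H →* Equiv.Perm ℚ :=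
  (MulAction.toPermHom ℚˣ ℚ).comp χ

theorem linearAction_apply {H : Type*} [Group H] (χ : H →* ℚˣ) (g : H) (x : ℚ) :
    linearAction χ g x = χ g * x := rfl

/-- The character `scale σ` is nontrivial on every nontrivial free factor of `N ⋊ ℤ`, when `N` is
free of finite rank. -/
theorem exists_scale_ne_one [IsFreeGroup N] [Nontrivial A] :
    ∃ a : A, scale σ (e.symm (Monoid.Coprod.inl a)) ≠ 1 := by
  by_contra! hA
  have hright : ∀ a : A, (e.symm (Monoid.Coprod.inl a)).right = 1 := fun a =>
    right_eq_one_of_scale_eq_one σ (hA a)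
  let j : A →* N :=
    { toFun := fun a => (e.symm (Monoid.Coprod.inl a)).left
      map_one' := by simp
      map_mul' := fun a b => by simp [hright] }
  have hj : Function.Injective j := fun a b hab =>
    Monoid.Coprod.inl_injective (e.symm.injective
      (SemidirectProduct.ext hab ((hright a).trans (hright b).symm)))
  have : IsFreeGroup A := IsFreeGroup.ofMulEquiv (MonoidHom.ofInjective hj).symm
  obtain ⟨f, hf⟩ := IsFreeGroup.exists_hom_rat_ne_one A
  refine hf (MonoidHom.ext fun a => ?_)
  let h : Monoid.Coprod A B →* Equiv.Perm ℚ :=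
    Monoid.Coprod.lift ((MulAction.toPermHom (Multiplicative ℚ) ℚ).comp f)
      (linearAction ((scale σ).comp (e.symm.toMonoidHom.comp Monoid.Coprod.inr)))
  have hinl : ∀ a x, h (Monoid.Coprod.inl a) x = (f a).toAdd + x := fun a x => by
    simp only [h, Monoid.Coprod.lift_apply_inl]
    rfl
  have h1 : h (Monoid.Coprod.inl a) = 1 := by
    refine eq_one_of_coprod_affine σ e h (fun a x => ?_) (fun b x => ?_) (hA a)
    · rw [hinl, hinl, hA]
      simp [add_comm]
    · simp [h, linearAction_apply]
  have h0 := hinl a 0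
  rw [h1, Equiv.Perm.one_apply, add_zero] at h0
  exact toAdd_eq_zero.1 h0.symm

end MappingTorus

open MappingTorus commutatorElement in
/-- A semidirect product of a finitely generated free group with `ℤ` is freely indecomposable. -/
theorem isEmpty_mulEquiv_coprod {N : Type*} [Group N] [Group.FG N] [IsFreeGroup N] (σ : MulAut N)
    (A B : Type*) [Group A] [Group B] [Nontrivial A] [Nontrivial B] :
    IsEmpty (SemidirectProduct N (Multiplicative ℤ) (zpowersHom (MulAut N) σ) ≃*
      Monoid.Coprod A B) := by
  refine ⟨fun e => ?_⟩
  obtain ⟨a, ha⟩ := exists_scale_ne_one σ e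
  obtain ⟨b, hb⟩ := exists_scale_ne_one σ (e.trans (MulEquiv.coprodComm A B))
  replace hb : scale σ (e.symm (Monoid.Coprod.inr b)) ≠ 1 := by simpa using hb
  let χ : Monoid.Coprod A B →* ℚˣ := (scale σ).comp e.symm.toMonoidHom
  let h : Monoid.Coprod A B →* Equiv.Perm ℚ :=
    Monoid.Coprod.lift (linearAction (χ.comp Monoid.Coprod.inl))
      ((MulAut.conj (Equiv.addRight (1 : ℚ))).toMonoidHom.comp
        (linearAction (χ.comp Monoid.Coprod.inr)))
  have hinl : ∀ a x, h (Monoid.Coprod.inl a) x = χ (Monoid.Coprod.inl a) * x := fun a x => by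
    simp [h, linearAction_apply]
  have hinr : ∀ b x, h (Monoid.Coprod.inr b) x = χ (Monoid.Coprod.inr b) * (x - 1) + 1 :=
    fun b x => by
      simp [h, linearAction_apply, sub_eq_add_neg]
  have hcomm : h ⁅(Monoid.Coprod.inl a : Monoid.Coprod A B), Monoid.Coprod.inr b⁆ = 1 := by
    refine eq_one_of_coprod_affine σ e h (fun a x => ?_) (fun b x => ?_) ?_
    · rw [hinl, hinl]
      simp [χ]
    · rw [hinr, hinr]
      simp only [χ, MonoidHom.comp_apply, MulEquiv.toMonoidHom_eq_coe, MonoidHom.coe_coe]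
      ring
    · rw [map_commutatorElement, map_commutatorElement, commutatorElement_eq_one_iff_mul_comm,
        mul_comm]
  rw [map_commutatorElement, commutatorElement_eq_one_iff_mul_comm] at hcomm
  have h0 := congrArg (fun p : Equiv.Perm ℚ => p 0) hcomm
  simp only [Equiv.Perm.mul_apply, hinl, hinr] at h0
  have hprod : ((χ (Monoid.Coprod.inl a) : ℚ) - 1) * ((χ (Monoid.Coprod.inr b) : ℚ) - 1) = 0 := by
    linarith
  rcases mul_eq_zero.1 hprod with h1 | h1
  · exact ha (Units.ext (sub_eq_zero.1 h1))
  · exact hb (Units.ext (sub_eq_zero.1 h1))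

theorem stmt6 (k : ℕ) (φ : MulAut (FreeGroup (Fin k)))
    (A B : Type*) [Group A] [Group B] [Nontrivial A] [Nontrivial B] :
    IsEmpty ((SemidirectProduct (FreeGroup (Fin k)) (Multiplicative ℤ)
      (zpowersHom (MulAut (FreeGroup (Fin k))) φ⁻¹)) ≃* Monoid.Coprod A B) :=
  isEmpty_mulEquiv_coprod φ⁻¹ A B
end

section
/- Let δ ≥ 0, let X be a (δ)-hyperbolic metric space and e ∈ X. Let (a_n), (a_n'), (b_n), (b_n') be sequences in X such that (a_n · a_n')_e → ∞ and (b_n · b_n')_e → ∞ as n → ∞, and such that for some constant K, (a_n · b_n)_e ≤ K and (a_n' · b_n')_e ≤ K for all n. Then there exists N such that for all n ≥ N, |(a_n · b_n)_e − (a_n' · b_n')_e| ≤ 2δ. -/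
open Filter

theorem gromovProd_comm {X : Type*} [MetricSpace X] (e a b : X) :
    gromovProd e a b = gromovProd e b a := by
  unfold gromovProd
  rw [dist_comm a b, add_comm (dist a e)]

/-- In a `(δ)`-hyperbolic space, replacing both arguments of a bounded Gromov product by
sufficiently close ones lowers it by at most `2δ`. -/
theorem IsDeltaHyperbolic.gromovProd_sub_le {X : Type*} [MetricSpace X] {δ K : ℝ}
    (hδ : 0 ≤ δ) (hhyp : IsDeltaHyperbolic X δ) {e a a' b b' : X}
    (ha : K + δ < gromovProd e a a') (hb : K + δ < gromovProd e b b')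
    (hK : gromovProd e a b ≤ K) (hK' : gromovProd e a' b' ≤ K) :
    gromovProd e a' b' - 2 * δ ≤ gromovProd e a b := by
  have h₁ := hhyp e a b a'
  have h₂ := hhyp e b a' b'
  rw [min_eq_right (by linarith : gromovProd e a' b' ≤ gromovProd e b b')] at h₂
  rcases min_cases (gromovProd e a a') (gromovProd e b a') with h | h <;> linarith

theorem stmt9 {X : Type*} [MetricSpace X] (δ : ℝ) (hδ : 0 ≤ δ)
    (hhyp : IsDeltaHyperbolic X δ) (e : X) (a a' b b' : ℕ → X)
    (ha : Tendsto (fun n => gromovProd e (a n) (a' n)) atTop atTop)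
    (hb : Tendsto (fun n => gromovProd e (b n) (b' n)) atTop atTop)
    (K : ℝ) (hK : ∀ n, gromovProd e (a n) (b n) ≤ K ∧ gromovProd e (a' n) (b' n) ≤ K) :
    ∃ N : ℕ, ∀ n ≥ N,
      |gromovProd e (a n) (b n) - gromovProd e (a' n) (b' n)| ≤ 2 * δ := by
  obtain ⟨N, hN⟩ := eventually_atTop.1
    ((ha.eventually_gt_atTop (K + δ)).and (hb.eventually_gt_atTop (K + δ)))
  refine ⟨N, fun n hn => ?_⟩
  obtain ⟨hA, hB⟩ := hN n hn
  obtain ⟨hk, hk'⟩ := hK n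
  have h₁ := hhyp.gromovProd_sub_le hδ hA hB hk hk'
  rw [gromovProd_comm] at hA hB
  have h₂ := hhyp.gromovProd_sub_le hδ hA hB hk' hk
  rw [abs_le]
  constructor <;> linarith
end

section
/- Let k ≥ 1, let F = F(a_1, …, a_k) be the free group on a_1, …, a_k, and let φ be the automorphism of F with φ(a_1) = a_1 and φ(a_i) = a_i a_{i−1} for 1 < i ≤ k. Fix r with 1 ≤ r ≤ k, let n ∈ ℤ, and let w be any element of the subgroup of F generated by a_1, …, a_r. Then the ordered list of letters equal to a_r or a_r^{−1} occurring in the reduced word representing φ^n(w) is identical (as a list of signed letters, in order) to the ordered list of letters equal to a_r or a_r^{−1} occurring in the reduced word representing w. -/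
/-- `AlternatingForm r K g l` says that `g = r^{b₁} u₁ ⋯ r^{bₘ} uₘ` with all `uᵢ ∈ K` and
`l = [b₁, …, bₘ]` the list of signs, where no cancellation of `r` against its inverse is possible:
if `bᵢ` and `bᵢ₊₁` differ, then `uᵢ ≠ 1`. -/
inductive AlternatingForm {α : Type*} (r : α) (K : Subgroup (FreeGroup α)) :
    FreeGroup α → List Bool → Prop
  | one : AlternatingForm r K 1 []
  | cons {b : Bool} {u g : FreeGroup α} {l : List Bool} (hu : u ∈ K)
      (hg : AlternatingForm r K g l) (hne : l.head? = some (!b) → u ≠ 1) :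
      AlternatingForm r K (FreeGroup.mk [(r, b)] * (u * g)) (b :: l)

namespace AlternatingForm

variable {α : Type*} {r : α} {K : Subgroup (FreeGroup α)}

/-- A product of an element avoiding `r` and an element whose reduced word is empty or starts
with `r^{±1}` involves no cancellation. -/
theorem toWord_mul_of_head [DecidableEq α] {u g : FreeGroup α}
    (hu : ∀ p ∈ u.toWord, p.1 ≠ r) (hg : ∀ p ∈ g.toWord.head?, p.1 = r) :
    (u * g).toWord = u.toWord ++ g.toWord := by
  rw [FreeGroup.toWord_mul]
  refine FreeGroup.IsReduced.reduce_eq ?_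
  refine List.IsChain.append FreeGroup.isReduced_toWord FreeGroup.isReduced_toWord ?_
  intro p hp q hq h
  exact absurd (h.trans (hg q hq)) (hu p (List.mem_of_mem_getLast? hp))

theorem head?_toWord_and_filter_toWord [DecidableEq α]
    (hK : ∀ u ∈ K, ∀ p ∈ u.toWord, p.1 ≠ r) {g : FreeGroup α} {l : List Bool}
    (h : AlternatingForm r K g l) :
    g.toWord.head? = l.head?.map (fun b => (r, b)) ∧
      g.toWord.filter (fun p => decide (p.1 = r)) = l.map (fun b => (r, b)) := by
  induction h with
  | one => simp
  | @cons b u g l hu hg hne ih =>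
    have hug : (u * g).toWord = u.toWord ++ g.toWord := by
      refine toWord_mul_of_head (hK u hu) ?_
      rw [ih.1]
      intro p hp
      simp only [Option.mem_def, Option.map_eq_some_iff] at hp
      obtain ⟨c, -, rfl⟩ := hp
      rfl
    have hword : (FreeGroup.mk [(r, b)] * (u * g)).toWord =
        (r, b) :: (u.toWord ++ g.toWord) := by
      rw [FreeGroup.toWord_mul, hug, FreeGroup.toWord_mk, FreeGroup.reduce_singleton]
      refine FreeGroup.IsReduced.reduce_eq ?_
      refine List.IsChain.append (List.isChain_singleton _)
        (hug ▸ FreeGroup.isReduced_toWord) ?_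
      intro p hp q hq hpq
      obtain rfl : (r, b) = p := by simpa using hp
      rcases hw : u.toWord with _ | ⟨s, t⟩
      · have h1 : u = 1 := FreeGroup.toWord_eq_nil_iff.mp hw
        rw [hw, List.nil_append, ih.1] at hq
        simp only [Option.mem_def, Option.map_eq_some_iff] at hq
        obtain ⟨c, hc, rfl⟩ := hq
        by_contra hbc
        refine hne ?_ h1
        rw [hc]
        cases b <;> cases c <;> simp_all
      · obtain rfl : s = q := by simpa [hw] using hq
        exact absurd hpq.symm (hK u hu s (by simp [hw]))
    refine ⟨by simp [hword], ?_⟩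
    have hnil : u.toWord.filter (fun p => decide (p.1 = r)) = [] := by
      simpa [List.filter_eq_nil_iff] using hK u hu
    simp [hword, hnil, ih.2]

theorem filter_toWord_mul [DecidableEq α]
    (hK : ∀ u ∈ K, ∀ p ∈ u.toWord, p.1 ≠ r) {u g : FreeGroup α} {l : List Bool}
    (hu : u ∈ K) (h : AlternatingForm r K g l) :
    (u * g).toWord.filter (fun p => decide (p.1 = r)) = l.map (fun b => (r, b)) := by
  obtain ⟨hhead, hfilter⟩ := h.head?_toWord_and_filter_toWord hK
  have hnil : u.toWord.filter (fun p => decide (p.1 = r)) = [] := by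
    simpa [List.filter_eq_nil_iff] using hK u hu
  rw [toWord_mul_of_head (hK u hu), List.filter_append, hnil, hfilter, List.nil_append]
  rw [hhead]
  intro p hp
  simp only [Option.mem_def, Option.map_eq_some_iff] at hp
  obtain ⟨c, -, rfl⟩ := hp
  rfl

/-- Elements admitting a decomposition are stable under left multiplication by `r^{±1}`. -/
theorem exists_letter_mul {u g : FreeGroup α} {l : List Bool} (hu : u ∈ K)
    (h : AlternatingForm r K g l) (b : Bool) :
    ∃ u' ∈ K, ∃ g' l', AlternatingForm r K g' l' ∧ FreeGroup.mk [(r, b)] * (u * g) = u' * g' := by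
  by_cases hc : l.head? = some (!b) → u ≠ 1
  · exact ⟨1, K.one_mem, _, _, cons hu h hc, (one_mul _).symm⟩
  · push Not at hc
    obtain ⟨hl, rfl⟩ := hc
    cases h with
    | one => simp at hl
    | @cons c v g l hv hg hne =>
      obtain rfl : c = !b := by simpa using hl
      refine ⟨v, hv, g, l, hg, ?_⟩
      have : FreeGroup.mk [(r, b)] * FreeGroup.mk [(r, !b)] = 1 := by
        rw [FreeGroup.mul_mk]
        exact Quot.sound FreeGroup.Red.Step.cons_not
      rw [one_mul, ← mul_assoc, this, one_mul]

theorem exists_of_mem_closure {S : Set (FreeGroup α)}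
    (hS : ∀ x ∈ S, x ∈ K ∨ x = FreeGroup.of r) {w : FreeGroup α}
    (hw : w ∈ Subgroup.closure S) :
    ∃ u ∈ K, ∃ g l, AlternatingForm r K g l ∧ w = u * g := by
  induction hw using Subgroup.closure_induction_left with
  | one => exact ⟨1, K.one_mem, 1, [], one, (one_mul _).symm⟩
  | mul_left x hx y _ ih =>
    obtain ⟨u, hu, g, l, hg, rfl⟩ := ih
    rcases hS x hx with hxK | rfl
    · exact ⟨x * u, K.mul_mem hxK hu, g, l, hg, (mul_assoc _ _ _).symm⟩
    · exact exists_letter_mul hu hg true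
  | inv_mul_cancel x hx y _ ih =>
    obtain ⟨u, hu, g, l, hg, rfl⟩ := ih
    rcases hS x hx with hxK | rfl
    · exact ⟨x⁻¹ * u, K.mul_mem (K.inv_mem hxK) hu, g, l, hg, (mul_assoc _ _ _).symm⟩
    · exact exists_letter_mul hu hg false

/-- An injective endomorphism preserving `K` and sending `r` to `r * c` with `c ∈ K` preserves
the list of signs. -/
theorem exists_map {φ : FreeGroup α →* FreeGroup α} (hinj : Function.Injective φ)
    (hφK : ∀ u ∈ K, φ u ∈ K) {c : FreeGroup α} (hc : c ∈ K)
    (hr : φ (FreeGroup.of r) = FreeGroup.of r * c) {g : FreeGroup α} {l : List Bool}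
    (h : AlternatingForm r K g l) :
    ∃ g', AlternatingForm r K g' l ∧
      φ g = (if l.head? = some false then c⁻¹ else 1) * g' := by
  induction h with
  | one => exact ⟨1, one, by simp⟩
  | @cons b u g l hu hg hne ih =>
    obtain ⟨g', hg', hφg⟩ := ih
    set e : FreeGroup α := if l.head? = some false then c⁻¹ else 1 with he
    have heK : e ∈ K := by
      rw [he]
      split_ifs
      exacts [K.inv_mem hc, K.one_mem]
    have hφu : u ≠ 1 → φ u ≠ 1 := fun h h' => h (hinj (h'.trans (map_one φ).symm))
    cases b with
    | true =>
      refine ⟨_, cons (b := true) (u := c * φ u * e)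
        (K.mul_mem (K.mul_mem hc (hφK u hu)) heK) hg' ?_, ?_⟩
      · intro hl h1
        have hl' : l.head? = some false := hl
        rw [he, if_pos hl', conj_eq_one_iff] at h1
        exact hφu (hne hl) h1
      · have hx : φ (FreeGroup.mk [(r, true)]) = FreeGroup.mk [(r, true)] * c := hr
        simp [hx, hφg, mul_assoc]
    | false =>
      refine ⟨_, cons (b := false) (u := φ u * e) (K.mul_mem (hφK u hu) heK) hg' ?_, ?_⟩
      · intro hl h1
        have hl' : l.head? = some true := hl
        rw [he, if_neg (by simp [hl']), mul_one] at h1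
        exact hφu (hne hl) h1
      · have hx : φ (FreeGroup.mk [(r, false)]) = c⁻¹ * FreeGroup.mk [(r, false)] := by
          have hinv : FreeGroup.mk [(r, false)] = (FreeGroup.of r)⁻¹ := rfl
          rw [hinv, map_inv, hr, mul_inv_rev]
        simp [hx, hφg, mul_assoc]

theorem filter_toWord_map [DecidableEq α] (hK : ∀ u ∈ K, ∀ p ∈ u.toWord, p.1 ≠ r)
    {φ : FreeGroup α →* FreeGroup α} (hinj : Function.Injective φ)
    (hφK : ∀ u ∈ K, φ u ∈ K) {c : FreeGroup α} (hc : c ∈ K)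
    (hr : φ (FreeGroup.of r) = FreeGroup.of r * c) {S : Set (FreeGroup α)}
    (hS : ∀ x ∈ S, x ∈ K ∨ x = FreeGroup.of r) {w : FreeGroup α}
    (hw : w ∈ Subgroup.closure S) :
    (φ w).toWord.filter (fun p => decide (p.1 = r)) =
      w.toWord.filter (fun p => decide (p.1 = r)) := by
  obtain ⟨u, hu, g, l, hg, rfl⟩ := exists_of_mem_closure hS hw
  obtain ⟨g', hg', hφg⟩ := hg.exists_map hinj hφK hc hr
  rw [hg.filter_toWord_mul hK hu, map_mul, hφg, ← mul_assoc]
  refine hg'.filter_toWord_mul hK (K.mul_mem (hφK u hu) ?_)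
  split_ifs
  exacts [K.inv_mem hc, K.one_mem]

end AlternatingForm

theorem FreeGroup.fst_ne_of_mem_closure {α : Type*} [DecidableEq α] {r : α}
    {S : Set (FreeGroup α)} (hS : ∀ x ∈ S, ∃ i, i ≠ r ∧ x = FreeGroup.of i) {u : FreeGroup α}
    (hu : u ∈ Subgroup.closure S) : ∀ p ∈ u.toWord, p.1 ≠ r := by
  induction hu using Subgroup.closure_induction with
  | mem x hx =>
    obtain ⟨i, hi, rfl⟩ := hS x hx
    simpa using hi
  | one => simp
  | mul x y _ _ hx hy =>
    intro p hp
    rcases List.mem_append.mp ((FreeGroup.toWord_mul_sublist x y).subset hp) with h | h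
    exacts [hx p h, hy p h]
  | inv x _ hx =>
    intro p hp
    rw [FreeGroup.toWord_inv] at hp
    simp only [FreeGroup.invRev, List.mem_reverse, List.mem_map] at hp
    obtain ⟨q, hq, rfl⟩ := hp
    exact hx q hq


theorem stmt11 (k : ℕ) (hk : 1 ≤ k)
    (φ : MulAut (FreeGroup (Fin k)))
    -- `φ` is the hydra automorphism: `φ a₁ = a₁` and `φ aᵢ = aᵢ aᵢ₋₁` for `i > 1`
    -- (here generators are indexed by `Fin k`, i.e. `0`-indexed).
    (hφ : ∀ i : Fin k, φ (FreeGroup.of i) =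
      if (i : ℕ) = 0 then FreeGroup.of i
      else FreeGroup.of i *
        FreeGroup.of ⟨(i : ℕ) - 1, lt_of_le_of_lt (Nat.sub_le _ _) i.isLt⟩)
    (r : Fin k) (n : ℤ)
    -- `w` lies in the subgroup generated by `a₁, …, a_r` (indices `≤ r`).
    (w : FreeGroup (Fin k))
    (hw : w ∈ Subgroup.closure {x : FreeGroup (Fin k) | ∃ i : Fin k, i ≤ r ∧ x = FreeGroup.of i}) :
    -- The ordered list of signed occurrences of `a_r` in the reduced word of `φⁿ w`
    -- is the same as that in the reduced word of `w`.
    ((φ ^ n) w).toWord.filter (fun p => decide (p.1 = r))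
      = w.toWord.filter (fun p => decide (p.1 = r)) := by
  have hlow : ∀ P : Fin k → Prop, (∀ i j : Fin k, j ≤ i → P i → P j) →
      ∀ u ∈ Subgroup.closure {x : FreeGroup (Fin k) | ∃ i, P i ∧ x = FreeGroup.of i},
        φ u ∈ Subgroup.closure {x : FreeGroup (Fin k) | ∃ i, P i ∧ x = FreeGroup.of i} := by
    intro P hP u hu
    induction hu using Subgroup.closure_induction with
    | mem x hx =>
      obtain ⟨i, hi, rfl⟩ := hx
      rw [hφ]
      split_ifs with h0
      · exact Subgroup.subset_closure ⟨i, hi, rfl⟩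
      · refine Subgroup.mul_mem _ (Subgroup.subset_closure ⟨i, hi, rfl⟩)
          (Subgroup.subset_closure ⟨_, hP i _ ?_ hi, rfl⟩)
        rw [Fin.le_def]
        exact Nat.sub_le _ _
    | one => simp
    | mul x y _ _ hx hy => rw [map_mul]; exact Subgroup.mul_mem _ hx hy
    | inv x _ hx => rw [map_inv]; exact Subgroup.inv_mem _ hx
  set H := Subgroup.closure {x : FreeGroup (Fin k) | ∃ i : Fin k, i ≤ r ∧ x = FreeGroup.of i}
    with hH
  have hφH : ∀ u ∈ H, φ u ∈ H := hlow (fun i => i ≤ r) fun i j hji hi => hji.trans hi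
  have hgen : ∀ m : ℕ, ∀ hm : m < k, m ≤ r → φ⁻¹ (FreeGroup.of ⟨m, hm⟩) ∈ H := by
    intro m
    induction m with
    | zero =>
      intro hm hmr
      have h : φ (FreeGroup.of ⟨0, hm⟩) = FreeGroup.of ⟨0, hm⟩ := by rw [hφ]; simp
      have h' : φ⁻¹ (FreeGroup.of ⟨0, hm⟩) = FreeGroup.of ⟨0, hm⟩ := by
        rw [MulAut.inv_apply, MulEquiv.symm_apply_eq, h]
      rw [h']
      exact Subgroup.subset_closure ⟨_, hmr, rfl⟩
    | succ m ih =>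
      intro hm hmr
      have h : φ (FreeGroup.of ⟨m + 1, hm⟩) =
          FreeGroup.of ⟨m + 1, hm⟩ * FreeGroup.of ⟨m, by omega⟩ := by rw [hφ]; simp
      have h' : φ⁻¹ (FreeGroup.of ⟨m + 1, hm⟩) =
          FreeGroup.of ⟨m + 1, hm⟩ * (φ⁻¹ (FreeGroup.of ⟨m, by omega⟩))⁻¹ := by
        rw [MulAut.inv_apply, MulEquiv.symm_apply_eq, map_mul, map_inv, h, MulAut.inv_apply,
          MulEquiv.apply_symm_apply, mul_inv_cancel_right]
      rw [h']
      exact H.mul_mem (Subgroup.subset_closure ⟨_, hmr, rfl⟩)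
        (H.inv_mem (ih (by omega) (by omega)))
  have hφH' : ∀ u ∈ H, φ⁻¹ u ∈ H := by
    intro u hu
    have hle : H ≤ H.comap (φ⁻¹ : MulAut (FreeGroup (Fin k))).toMonoidHom := by
      rw [hH, Subgroup.closure_le]
      rintro x ⟨i, hi, rfl⟩
      exact hgen i i.isLt hi
    exact hle hu
  have hstep : ∀ v ∈ H, (φ v).toWord.filter (fun p => decide (p.1 = r)) =
      v.toWord.filter (fun p => decide (p.1 = r)) := by
    intro v hv
    set K := Subgroup.closure {x : FreeGroup (Fin k) | ∃ i : Fin k, i < r ∧ x = FreeGroup.of i}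
    obtain ⟨c, hc, hrc⟩ : ∃ c ∈ K, φ (FreeGroup.of r) = FreeGroup.of r * c := by
      by_cases h0 : (r : ℕ) = 0
      · exact ⟨1, K.one_mem, by rw [hφ, if_pos h0, mul_one]⟩
      · refine ⟨_, Subgroup.subset_closure ⟨_, ?_, rfl⟩, by rw [hφ, if_neg h0]⟩
        rw [Fin.lt_def]
        exact Nat.sub_lt (Nat.pos_of_ne_zero h0) one_pos
    refine AlternatingForm.filter_toWord_map (K := K) (φ := φ.toMonoidHom) (c := c)
      (fun u hu => FreeGroup.fst_ne_of_mem_closure ?_ hu) φ.injective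
      (hlow (fun i => i < r) fun i j hji hi => hji.trans_lt hi) hc hrc ?_ hv
    · rintro x ⟨i, hi, rfl⟩
      exact ⟨i, hi.ne, rfl⟩
    · rintro x ⟨i, hi, rfl⟩
      rcases hi.lt_or_eq with h | rfl
      exacts [Or.inl (Subgroup.subset_closure ⟨i, h, rfl⟩), Or.inr rfl]
  suffices h : (φ ^ n) w ∈ H ∧ ((φ ^ n) w).toWord.filter (fun p => decide (p.1 = r)) =
      w.toWord.filter (fun p => decide (p.1 = r)) from h.2
  induction n using Int.induction_on with
  | zero => exact ⟨by simpa using hw, by simp⟩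
  | succ m ih =>
    rw [add_comm, zpow_add, zpow_one, MulAut.mul_apply]
    exact ⟨hφH _ ih.1, (hstep _ ih.1).trans ih.2⟩
  | pred m ih =>
    rw [sub_eq_add_neg, add_comm, zpow_add, zpow_neg_one, MulAut.mul_apply]
    refine ⟨hφH' _ ih.1, Eq.trans ?_ ih.2⟩
    rw [← hstep _ (hφH' _ ih.1), MulAut.apply_inv_self]
end

section
/- Let k ≥ 1, let F = F(a_1, …, a_k) be the free group on a_1, …, a_k, and let φ be the automorphism of F with φ(a_1) = a_1 and φ(a_i) = a_i a_{i−1} for 1 < i ≤ k. Then for every r with 1 ≤ r ≤ k and every n ∈ ℤ, the element a_r^{−1} · φ^n(a_r) lies in the subgroup of F generated by a_1, …, a_{r−1} (the trivial subgroup when r = 1). -/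
/-- The subgroup of a free group generated by the generators preceding `r`. -/
def lowerSubgroup {ι : Type*} [Preorder ι] (r : ι) : Subgroup (FreeGroup ι) :=
  Subgroup.closure {x | ∃ i, i < r ∧ x = FreeGroup.of i}

/-- An automorphism is unitriangular if it multiplies each generator on the right by an element
of the subgroup generated by the preceding ones. -/
def IsUnitriangular {ι : Type*} [Preorder ι] (ψ : MulAut (FreeGroup ι)) : Prop :=
  ∀ r, (FreeGroup.of r)⁻¹ * ψ (FreeGroup.of r) ∈ lowerSubgroup r

section

variable {ι : Type*} [Preorder ι]

theorem of_mem_lowerSubgroup {i r : ι} (h : i < r) : FreeGroup.of i ∈ lowerSubgroup r :=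
  Subgroup.subset_closure ⟨i, h, rfl⟩

theorem lowerSubgroup_mono {i r : ι} (h : i ≤ r) : lowerSubgroup i ≤ lowerSubgroup r :=
  Subgroup.closure_mono fun _ ⟨j, hj, hx⟩ => ⟨j, hj.trans_le h, hx⟩

theorem IsUnitriangular.one : IsUnitriangular (1 : MulAut (FreeGroup ι)) := fun r => by
  simp [one_mem]

theorem apply_of_mem_lowerSubgroup {ψ : MulAut (FreeGroup ι)} {i r : ι}
    (h : (FreeGroup.of i)⁻¹ * ψ (FreeGroup.of i) ∈ lowerSubgroup i) (hir : i < r) :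
    ψ (FreeGroup.of i) ∈ lowerSubgroup r := by
  simpa using mul_mem (of_mem_lowerSubgroup hir) (lowerSubgroup_mono hir.le h)

theorem IsUnitriangular.map_mem {ψ : MulAut (FreeGroup ι)} (hψ : IsUnitriangular ψ) {r : ι}
    {x : FreeGroup ι} (hx : x ∈ lowerSubgroup r) : ψ x ∈ lowerSubgroup r := by
  have h : lowerSubgroup r ≤ (lowerSubgroup r).comap ψ.toMonoidHom := by
    refine (Subgroup.closure_le _).2 ?_
    rintro _ ⟨i, hi, rfl⟩
    exact apply_of_mem_lowerSubgroup (hψ i) hi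
  exact h hx

theorem IsUnitriangular.mul {ψ χ : MulAut (FreeGroup ι)} (hψ : IsUnitriangular ψ)
    (hχ : IsUnitriangular χ) : IsUnitriangular (ψ * χ) := fun r => by
  simpa [mul_assoc] using mul_mem (hψ r) (hψ.map_mem (hχ r))

theorem IsUnitriangular.zpow {ψ : MulAut (FreeGroup ι)} (hψ : IsUnitriangular ψ)
    (hψ' : IsUnitriangular ψ⁻¹) (n : ℤ) : IsUnitriangular (ψ ^ n) := by
  induction n with
  | zero => simpa using IsUnitriangular.one
  | succ n ih => rw [zpow_add_one]; exact ih.mul hψ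
  | pred n ih => rw [zpow_sub_one]; exact ih.mul hψ'

end

theorem stmt12 (k : ℕ) (hk : 1 ≤ k)
    (φ : MulAut (FreeGroup (Fin k)))
    -- `φ` is the hydra automorphism: `φ a₁ = a₁` and `φ aᵢ = aᵢ aᵢ₋₁` for `i > 1`
    -- (here generators are indexed by `Fin k`, i.e. `0`-indexed).
    (hφ : ∀ i : Fin k, φ (FreeGroup.of i) =
      if (i : ℕ) = 0 then FreeGroup.of i
      else FreeGroup.of i *
        FreeGroup.of ⟨(i : ℕ) - 1, lt_of_le_of_lt (Nat.sub_le _ _) i.isLt⟩)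
    (r : Fin k) (n : ℤ) :
    -- `a_r⁻¹ · φⁿ(a_r)` lies in the subgroup generated by the `a_i` with `i < r`
    -- (the trivial subgroup when `r` is the first generator).
    (FreeGroup.of r)⁻¹ * (φ ^ n) (FreeGroup.of r)
      ∈ Subgroup.closure {x : FreeGroup (Fin k) | ∃ i : Fin k, i < r ∧ x = FreeGroup.of i} := by
  have hpos : IsUnitriangular φ := by
    intro i
    rw [hφ i]
    split_ifs with h
    · simp [one_mem]
    · rw [inv_mul_cancel_left]
      exact of_mem_lowerSubgroup (Fin.lt_def.2 (Nat.sub_one_lt h))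
  have hneg : IsUnitriangular φ⁻¹ := by
    intro i
    induction i using WellFoundedLT.induction with
    | ind i ih =>
      have hi := congrArg (φ⁻¹ : MulAut _) (hφ i)
      rw [MulAut.inv_apply_self] at hi
      split_ifs at hi with h
      · rw [← hi, inv_mul_cancel]
        exact one_mem _
      · have hlt : (⟨(i : ℕ) - 1, lt_of_le_of_lt (Nat.sub_le _ _) i.isLt⟩ : Fin k) < i :=
          Fin.lt_def.2 (Nat.sub_one_lt h)
        rw [map_mul] at hi
        rw [← inv_mem_iff, mul_inv_rev, inv_inv, ← eq_inv_mul_of_mul_eq hi.symm]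
        exact apply_of_mem_lowerSubgroup (ih _ hlt) hlt
  exact hpos.zpow hneg n r
end
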